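/- arXiv:2012.05636 — 2 statements merged into one kernel-verified Lean document; each statement's English description precedes it below -/
import Mathlib

section
/- The monodromy action of SL₂(ℤ) on mixed 2- and 4-torsion data is transitive in the following sense: for any two pairs (v, w) and (v', w') with v, v' ∈ (ℤ/2ℤ)² and w, w' ∈ (ℤ/4ℤ)², such that v ≠ 0, the mod-2 reduction w̄ of w is nonzero and w̄ ≠ v, and likewise v' ≠ 0, the mod-2 reduction w̄' of w' is nonzero and w̄' ≠ v', there exists a matrix M ∈ SL₂(ℤ) whose reduction modulo 2 sends v to v' and whose reduction modulo 4 sends w to w' (acting by matrix–vector multiplication). -/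
open Matrix

/-- The coordinatewise reduction map (ℤ/4ℤ)² → (ℤ/2ℤ)². -/
def red42 (w : Fin 2 → ZMod 4) : Fin 2 → ZMod 2 :=
  fun i => ZMod.castHom (by norm_num : (2:ℕ) ∣ 4) (ZMod 2) (w i)

/-- Every admissible pair of torsion vectors consists of the reductions of the columns of a matrix
in SL₂(ℤ): `w` modulo 4 is the first column and `v` modulo 2 the second. -/
theorem exists_sl2_columns (v : Fin 2 → ZMod 2) (w : Fin 2 → ZMod 4)
    (hv : v ≠ 0) (hw : red42 w ≠ 0) (hvw : red42 w ≠ v) :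
    ∃ M : Matrix.SpecialLinearGroup (Fin 2) ℤ,
      ((M : Matrix (Fin 2) (Fin 2) ℤ).map (Int.cast : ℤ → ZMod 2)) *ᵥ ![0, 1] = v ∧
      ((M : Matrix (Fin 2) (Fin 2) ℤ).map (Int.cast : ℤ → ZMod 4)) *ᵥ ![1, 0] = w := by
  have key : ∀ (x y : ZMod 2) (p q : ZMod 4), ![x, y] ≠ 0 → red42 ![p, q] ≠ 0 →
      red42 ![p, q] ≠ ![x, y] →
      ∃ a ∈ [-1, 0, 1, 2], ((a : ℤ) : ZMod 4) = p ∧ ∃ c ∈ [-1, 0, 1, 2], ((c : ℤ) : ZMod 4) = q ∧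
      ∃ b ∈ [-1, 0, 1, 2], ((b : ℤ) : ZMod 2) = x ∧ ∃ d ∈ [-1, 0, 1, 2], ((d : ℤ) : ZMod 2) = y ∧
        a * d - b * c = 1 := by
    decide
  have hv_eta : ![v 0, v 1] = v := by ext i; fin_cases i <;> rfl
  have hw_eta : ![w 0, w 1] = w := by ext i; fin_cases i <;> rfl
  obtain ⟨a, -, ha, c, -, hc, b, -, hb, d, -, hd, hdet⟩ :=
    key (v 0) (v 1) (w 0) (w 1) (by rwa [hv_eta]) (by rwa [hw_eta]) (by rwa [hv_eta, hw_eta])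
  refine ⟨⟨!![a, b; c, d], by rw [Matrix.det_fin_two_of, hdet]⟩, ?_, ?_⟩
  · ext i
    fin_cases i <;> simp [Matrix.mulVec, dotProduct, hb, hd]
  · ext i
    fin_cases i <;> simp [Matrix.mulVec, dotProduct, ha, hc]

/-- Transitivity of the monodromy action of SL₂(ℤ) on mixed 2- and 4-torsion
data: given pairs (v, w) and (v', w') with v, v' ∈ (ℤ/2ℤ)², w, w' ∈ (ℤ/4ℤ)²,
with v ≠ 0, the mod-2 reduction of w nonzero and different from v, and likewise
for (v', w'), there is M ∈ SL₂(ℤ) whose reduction mod 2 sends v to v' and whose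
reduction mod 4 sends w to w'. -/
theorem sl2_transitive_on_mixed_torsion_pairs
    (v v' : Fin 2 → ZMod 2) (w w' : Fin 2 → ZMod 4)
    (hv : v ≠ 0) (hw : red42 w ≠ 0) (hvw : red42 w ≠ v)
    (hv' : v' ≠ 0) (hw' : red42 w' ≠ 0) (hvw' : red42 w' ≠ v') :
    ∃ M : Matrix.SpecialLinearGroup (Fin 2) ℤ,
      ((M : Matrix (Fin 2) (Fin 2) ℤ).map (Int.cast : ℤ → ZMod 2)) *ᵥ v = v' ∧
      ((M : Matrix (Fin 2) (Fin 2) ℤ).map (Int.cast : ℤ → ZMod 4)) *ᵥ w = w' := by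
  obtain ⟨A, hAv, hAw⟩ := exists_sl2_columns v w hv hw hvw
  obtain ⟨B, hBv, hBw⟩ := exists_sl2_columns v' w' hv' hw' hvw'
  have cancel (n : ℕ) (u : Fin 2 → ZMod n) :
      ((B * A⁻¹ : Matrix.SpecialLinearGroup (Fin 2) ℤ) : Matrix (Fin 2) (Fin 2) ℤ).map
          (Int.cast : ℤ → ZMod n) *ᵥ
        ((A : Matrix (Fin 2) (Fin 2) ℤ).map (Int.cast : ℤ → ZMod n) *ᵥ u) =
      (B : Matrix (Fin 2) (Fin 2) ℤ).map (Int.cast : ℤ → ZMod n) *ᵥ u := by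
    have h := Matrix.map_mul (L := ((B * A⁻¹ : Matrix.SpecialLinearGroup (Fin 2) ℤ) :
      Matrix (Fin 2) (Fin 2) ℤ)) (M := (A : Matrix (Fin 2) (Fin 2) ℤ))
      (f := Int.castRingHom (ZMod n))
    rw [← Matrix.SpecialLinearGroup.coe_mul, inv_mul_cancel_right] at h
    rw [Matrix.mulVec_mulVec]
    exact congrArg (· *ᵥ u) h.symm
  exact ⟨B * A⁻¹, by rw [← hAv, cancel, hBv], by rw [← hAw, cancel, hBw]⟩
end

section
/- Let F be a homogeneous polynomial of degree 4 in three variables x, y, z over ℂ in which every monomial with nonzero coefficient has even exponent in each of the three variables (F is biquadratic). Suppose there exist α, β ∈ ℂ such that F(0, y, z) = (α·y² + β·z²)² identically. Then for every (y₀, z₀) ∈ ℂ² with (y₀, z₀) ≠ (0, 0) and α·y₀² + β·z₀² = 0, the polynomial F and all three of its partial derivatives ∂F/∂x, ∂F/∂y, ∂F/∂z vanish at the point (0, y₀, z₀); in particular, the projective quartic curve {F = 0} is singular at (0 : y₀ : z₀). Consequently, a smooth biquadratic plane quartic has no coordinate line as a bitangent. -/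
open MvPolynomial

/-- Restricting a polynomial to a line parallel to the `i`-th axis turns `pderiv i` into the
univariate derivative. -/
lemma derivative_aeval_update_X {σ R : Type*} [DecidableEq σ] [CommSemiring R]
    (v : σ → R) (i : σ) (F : MvPolynomial σ R) :
    Polynomial.derivative
        (aeval (Function.update (fun j => Polynomial.C (v j)) i Polynomial.X) F) =
      aeval (Function.update (fun j => Polynomial.C (v j)) i Polynomial.X) (pderiv i F) := by
  induction F using MvPolynomial.induction_on with
  | C a => simp [Polynomial.algebraMap_eq]
  | add p q hp hq => simp [hp, hq]
  | mul_X p j hp =>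
    rw [map_mul, Polynomial.derivative_mul, hp, Derivation.leibniz, aeval_X]
    by_cases hj : j = i
    · subst hj
      simp [mul_comm, add_comm]
    · simp [hj, pderiv_X, mul_comm]

lemma eval_aeval_update_X {σ R : Type*} [DecidableEq σ] [CommSemiring R]
    (v : σ → R) (i : σ) (t : R) (F : MvPolynomial σ R) :
    (aeval (Function.update (fun j => Polynomial.C (v j)) i Polynomial.X) F).eval t =
      eval (Function.update v i t) F := by
  induction F using MvPolynomial.induction_on with
  | C a => simp [Polynomial.algebraMap_eq]
  | add p q hp hq => simp [hp, hq]
  | mul_X p j hp =>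
    rw [map_mul, Polynomial.eval_mul, hp, map_mul, aeval_X, eval_X]
    by_cases hj : j = i
    · subst hj
      simp
    · simp [hj]

/-- If `F` agrees with the univariate polynomial `p` along the line through `v` parallel to the
`i`-th axis, then `pderiv i F` at `v` is the derivative of `p` at `v i`. -/
lemma eval_pderiv_eq_of_forall_eval_update {σ R : Type*} [DecidableEq σ] [CommRing R]
    [IsDomain R] [Infinite R] (v : σ → R) (i : σ) (F : MvPolynomial σ R) (p : Polynomial R)
    (h : ∀ t, eval (Function.update v i t) F = p.eval t) :
    eval v (pderiv i F) = (Polynomial.derivative p).eval (v i) := by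
  have hp : aeval (Function.update (fun j => Polynomial.C (v j)) i Polynomial.X) F = p :=
    Polynomial.funext fun t => by rw [eval_aeval_update_X, h]
  rw [← hp, derivative_aeval_update_X, eval_aeval_update_X, Function.update_eq_self]

/-- The `i`-th partial derivative of a polynomial even in the `i`-th variable vanishes on the
`i`-th coordinate hyperplane. -/
lemma eval_pderiv_eq_zero_of_even {σ R : Type*} [CommSemiring R] (F : MvPolynomial σ R)
    (i : σ) (hF : ∀ d ∈ F.support, Even (d i)) (v : σ → R) (hv : v i = 0) :
    eval v (pderiv i F) = 0 := by
  classical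
  rw [F.as_sum, map_sum, map_sum]
  refine Finset.sum_eq_zero fun d hd => ?_
  rw [pderiv_monomial, eval_monomial]
  obtain h0 | h0 := eq_or_ne (d i) 0
  · simp [h0]
  · have h1 : (d - Finsupp.single i 1 : σ →₀ ℕ) i ≠ 0 := by
      obtain ⟨k, hk⟩ := hF d hd
      simp only [Finsupp.tsub_apply, Finsupp.single_eq_same]
      omega
    rw [Finsupp.prod, Finset.prod_eq_zero (Finsupp.mem_support_iff.mpr h1), mul_zero]
    rw [hv, zero_pow h1]

/-- Let F ∈ ℂ[x,y,z] be a biquadratic homogeneous quartic (every monomial has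
even exponent in each variable) whose restriction to the line {x = 0} is the
square (α·y² + β·z²)².  Then at every nonzero point (0, y₀, z₀) with
α·y₀² + β·z₀² = 0, both F and all three of its partial derivatives vanish; in
particular the projective quartic {F = 0} is singular at (0 : y₀ : z₀). -/
theorem biquadratic_quartic_singular_on_coordinate_bitangent
    (F : MvPolynomial (Fin 3) ℂ)
    (hhom : F.IsHomogeneous 4)
    (hbi : ∀ d ∈ F.support, Even (d 0) ∧ Even (d 1) ∧ Even (d 2))
    (α β : ℂ)
    (hres : ∀ y z : ℂ, eval ![0, y, z] F = (α * y ^ 2 + β * z ^ 2) ^ 2)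
    (y₀ z₀ : ℂ) (hnz : (y₀, z₀) ≠ (0, 0))
    (hvan : α * y₀ ^ 2 + β * z₀ ^ 2 = 0) :
    eval ![0, y₀, z₀] F = 0 ∧
    ∀ i : Fin 3, eval ![0, y₀, z₀] (pderiv i F) = 0 := by
  refine ⟨by rw [hres, hvan, zero_pow two_ne_zero], fun i => ?_⟩
  fin_cases i
  · exact eval_pderiv_eq_zero_of_even F 0 (fun d hd => (hbi d hd).1) _ rfl
  · have hline (t : ℂ) : Function.update ![0, y₀, z₀] 1 t = ![0, t, z₀] := by
      ext j; fin_cases j <;> simp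
    refine (eval_pderiv_eq_of_forall_eval_update ![0, y₀, z₀] 1 F
      ((Polynomial.C α * Polynomial.X ^ 2 + Polynomial.C (β * z₀ ^ 2)) ^ 2)
      fun t => by rw [hline, hres]; simp).trans ?_
    simp [Polynomial.derivative_pow, hvan]
  · have hline (t : ℂ) : Function.update ![0, y₀, z₀] 2 t = ![0, y₀, t] := by
      ext j; fin_cases j <;> simp
    refine (eval_pderiv_eq_of_forall_eval_update ![0, y₀, z₀] 2 F
      ((Polynomial.C (α * y₀ ^ 2) + Polynomial.C β * Polynomial.X ^ 2) ^ 2)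
      fun t => by rw [hline, hres]; simp).trans ?_
    simp [Polynomial.derivative_pow, hvan]
end
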